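/- Over a field K of characteristic 2, two non-diagonalizable quadratic forms in two variables are equivalent if and only if their Arf invariants are equal and they share a common non-zero value. -/

import Mathlib

open Matrix

theorem aux_tr {K : Type*} [Field K] (M : Matrix (Fin 2) (Fin 2) K) :
    (!![(0 : K), 1; -1, 0] * M).trace = M 1 0 - M 0 1 := by
  simp [Matrix.trace_fin_two, Matrix.vecMul, dotProduct, Fin.sum_univ_two, sub_eq_add_neg]

theorem aux_q {K : Type*} [Field K] (M : Matrix (Fin 2) (Fin 2) K) (v : Fin 2 → K) :
    v ⬝ᵥ M.mulVec v = M 0 0 * v 0 ^ 2 + (M 0 1 + M 1 0) * (v 0 * v 1) + M 1 1 * v 1 ^ 2 := by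
  simp [Matrix.mulVec, dotProduct, Fin.sum_univ_two]
  ring

/-- Equivalent forms have the same Arf invariant. -/
theorem aux_fwd {K : Type*} [Field K] [CharP K 2]
    (M M' A : Matrix (Fin 2) (Fin 2) K)
    (hM : M 1 0 - M 0 1 ≠ 0) (hM' : M' 1 0 - M' 0 1 ≠ 0)
    (h : ∀ v : Fin 2 → K, v ⬝ᵥ M'.mulVec v = (A.mulVec v) ⬝ᵥ M.mulVec (A.mulVec v)) :
    ∃ t : K, M.det / (M 1 0 - M 0 1) ^ 2 - M'.det / (M' 1 0 - M' 0 1) ^ 2 = t + t ^ 2 := by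
  have two : (2 : K) = 0 := CharTwo.two_eq_zero
  have h1 := h ![1, 0]
  have h2 := h ![0, 1]
  have h3 := h ![1, 1]
  simp only [aux_q] at h1 h2 h3
  simp [Matrix.mulVec, dotProduct, Fin.sum_univ_two] at h1 h2 h3
  rw [Matrix.det_fin_two, Matrix.det_fin_two]
  generalize M 0 0 = a at *
  generalize M 0 1 = b at *
  generalize M 1 0 = c at *
  generalize M 1 1 = d at *
  generalize M' 0 0 = a' at *
  generalize M' 0 1 = b' at *
  generalize M' 1 0 = c' at *
  generalize M' 1 1 = d' at *
  generalize A 0 0 = p at *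
  generalize A 0 1 = q at *
  generalize A 1 0 = r at *
  generalize A 1 1 = u at *
  have hs : c' - b' = (c - b) * (p * u - q * r) := by
    linear_combination h3 - h1 - h2 + (a * p * q + d * r * u - b' + c * q * r + b * p * u) * two
  have hD : p * u - q * r ≠ 0 := by
    intro h0
    rw [h0] at hs
    simp at hs
    exact hM' hs
  set n := a * p * q + b * p * u + c * r * q + d * r * u with hn
  set m := a * p * q + c * p * u + b * r * q + d * r * u with hm
  have hmn : m - n = c' - b' := by rw [hs, hm, hn]; ring
  have hdet : (a * d - b * c) * (p * u - q * r) ^ 2 = a' * d' - n * m := by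
    rw [h1, h2, hm, hn]; ring
  refine ⟨(n - b') / (c' - b'), ?_⟩
  have e1 : (a * d - b * c) / (c - b) ^ 2 = (a' * d' - n * m) / (c' - b') ^ 2 := by
    rw [← hdet, hs]; field_simp
  rw [e1]
  have hm2 : m = n + c' - b' := by linear_combination hmn
  rw [hm2]
  field_simp
  linear_combination (b' * n - n * c' + b' * c' - n ^ 2 + b' * n - b' ^ 2) * two

/-- Normal form with a prescribed first basis vector. -/
theorem aux_nf {K : Type*} [Field K] [CharP K 2]
    (M : Matrix (Fin 2) (Fin 2) K) (hM : M 1 0 - M 0 1 ≠ 0)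
    (v : Fin 2 → K) (hv : v ≠ 0) :
    ∃ (P : Matrix (Fin 2) (Fin 2) K) (β : K), IsUnit P.det ∧
      ∀ z : Fin 2 → K, z ⬝ᵥ (!![v ⬝ᵥ M.mulVec v, 0; 1, β]).mulVec z
        = (P.mulVec z) ⬝ᵥ M.mulVec (P.mulVec z) := by
  have two : (2 : K) = 0 := CharTwo.two_eq_zero
  have key : ∃ x y : K, (M 1 0 - M 0 1) * (v 0 * y - v 1 * x) = 1 := by
    by_cases h0 : v 0 = 0
    · have h1 : v 1 ≠ 0 := by
        intro h1
        apply hv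
        ext i
        fin_cases i <;> simp [h0, h1]
      refine ⟨-1 / ((M 1 0 - M 0 1) * v 1), 0, ?_⟩
      field_simp
      ring
    · refine ⟨0, 1 / ((M 1 0 - M 0 1) * v 0), ?_⟩
      field_simp
      ring
  obtain ⟨x, y, hxy⟩ := key
  refine ⟨!![v 0, x; v 1, y], ![x, y] ⬝ᵥ M.mulVec ![x, y], ?_, ?_⟩
  · rw [Matrix.det_fin_two, isUnit_iff_ne_zero]
    intro h
    simp at h
    have : (M 1 0 - M 0 1) * (v 0 * y - v 1 * x) = 0 := by
      linear_combination (M 1 0 - M 0 1) * h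
    rw [hxy] at this
    exact one_ne_zero this
  · intro z
    simp only [aux_q]
    simp [Matrix.mulVec, dotProduct, Fin.sum_univ_two]
    generalize M 0 0 = a at *
    generalize M 0 1 = b at *
    generalize M 1 0 = c at *
    generalize M 1 1 = d at *
    linear_combination (-z 0 * z 1) * hxy
      - z 0 * z 1 * (a * v 0 * x + d * v 1 * y + b * v 0 * y + c * v 1 * x) * two

theorem aux_shift {K : Type*} [Field K] [CharP K 2] (α β β' t : K)
    (h : α * β - α * β' = t + t ^ 2) :
    ∃ P : Matrix (Fin 2) (Fin 2) K, IsUnit P.det ∧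
      ∀ z : Fin 2 → K, z ⬝ᵥ (!![α, 0; 1, β']).mulVec z
        = (P.mulVec z) ⬝ᵥ (!![α, 0; 1, β]).mulVec (P.mulVec z) := by
  have two : (2 : K) = 0 := CharTwo.two_eq_zero
  have key : ∃ k : K, β' = α * k ^ 2 + k + β := by
    by_cases h0 : α = 0
    · exact ⟨β' - β, by rw [h0]; ring⟩
    · refine ⟨t / α, ?_⟩
      field_simp
      linear_combination -h - (t + t ^ 2) * two
  obtain ⟨k, hk⟩ := key
  refine ⟨!![1, k; 0, 1], by simp [Matrix.det_fin_two], ?_⟩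
  intro z
  simp only [aux_q]
  simp [Matrix.mulVec, dotProduct, Fin.sum_univ_two]
  rw [hk]
  linear_combination (-α * k * z 0 * z 1) * two

/-- Equivalence of non-diagonalizable binary quadratic forms in characteristic 2:
they are equivalent iff their Arf invariants agree and they share a non-zero value. -/
theorem nondiagonalizable_equiv_iff {K : Type*} [Field K] [CharP K 2]
    (M M' : Matrix (Fin 2) (Fin 2) K)
    (hM : (!![(0 : K), 1; -1, 0] * M).trace ≠ 0)
    (hM' : (!![(0 : K), 1; -1, 0] * M').trace ≠ 0) :
    (∃ A : Matrix (Fin 2) (Fin 2) K, IsUnit A.det ∧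
        ∀ v : Fin 2 → K, v ⬝ᵥ M'.mulVec v = (A.mulVec v) ⬝ᵥ M.mulVec (A.mulVec v)) ↔
      ((∃ t : K,
          M.det / ((!![(0 : K), 1; -1, 0] * M).trace) ^ 2
            - M'.det / ((!![(0 : K), 1; -1, 0] * M').trace) ^ 2 = t + t ^ 2) ∧
        (∃ v w : Fin 2 → K, v ≠ 0 ∧ w ≠ 0 ∧ v ⬝ᵥ M.mulVec v = w ⬝ᵥ M'.mulVec w)) := by
  simp only [aux_tr] at hM hM' ⊢
  constructor
  · rintro ⟨A, hA, h⟩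
    refine ⟨aux_fwd M M' A hM hM' h, A.mulVec ![1, 0], ![1, 0], ?_, ?_, (h _).symm⟩
    · intro h0
      have hinj := Matrix.mulVec_injective_of_isUnit ((Matrix.isUnit_iff_isUnit_det A).2 hA)
      have := hinj (h0.trans (Matrix.mulVec_zero A).symm)
      simpa using congrFun this 0
    · intro h0
      simpa using congrFun h0 0
  · rintro ⟨⟨t, ht⟩, v, w, hv, hw, hvw⟩
    have two : (2 : K) = 0 := CharTwo.two_eq_zero
    obtain ⟨P, β, hP, hPq⟩ := aux_nf M hM v hv
    obtain ⟨Q, β', hQ, hQq⟩ := aux_nf M' hM' w hw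
    rw [← hvw] at hQq
    generalize v ⬝ᵥ M.mulVec v = α at *
    obtain ⟨t1, h1⟩ := aux_fwd M _ P hM (by simp) hPq
    obtain ⟨t2, h2⟩ := aux_fwd M' _ Q hM' (by simp) hQq
    simp [Matrix.det_fin_two] at h1 h2 ht
    obtain ⟨R, hR, hRq⟩ := aux_shift α β β' (t + t1 + t2) (by
      linear_combination ht - h1 + h2 - (t1 + t1 ^ 2 + t * t1 + t * t2 + t1 * t2) * two)
    refine ⟨P * R * Q⁻¹, ?_, ?_⟩
    · rw [Matrix.det_mul, Matrix.det_mul]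
      exact (hP.mul hR).mul (Matrix.isUnit_nonsing_inv_det Q hQ)
    · intro z
      have e := hQq (Q⁻¹.mulVec z)
      rw [hRq, hPq] at e
      simp only [Matrix.mulVec_mulVec, Matrix.mul_nonsing_inv Q hQ, Matrix.one_mulVec] at e
      rw [← e, Matrix.mul_assoc, Matrix.mulVec_mulVec]
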